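/- Let n ≥ 2, k ≥ 0 and i ≥ 2. For every choice of basepoints there is a group isomorphism π_i(Conf_n(ℝ³ ∖ Q_k)) ≅ π_i(ℝ³ ∖ Q_k) × π_i(Conf_{n−1}(ℝ³ ∖ Q_{k+1})). (This is the splitting of the long exact homotopy sequence of the Fadell–Neuwirth fibration pr_{k,n}, which admits a cross section.) -/

import Mathlib

open scoped Topology

noncomputable section

/-- `ℝ³` with the Euclidean metric. -/
abbrev R3 : Type := EuclideanSpace ℝ (Fin 3)

/-- The configuration space of `n` (ordered, distinct) points in the subset `A ⊆ ℝ³`,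
topologised as a subspace of `(ℝ³)^n`. -/
def Conf (n : ℕ) (A : Set R3) : Type :=
  {x : Fin n → R3 // Function.Injective x ∧ ∀ m, x m ∈ A}

instance (n : ℕ) (A : Set R3) : TopologicalSpace (Conf n A) :=
  instTopologicalSpaceSubtype

/-- The point `q_m = (4(m−1), 0, 0) ∈ ℝ³`. -/
def qpt (m : ℕ) : R3 := EuclideanSpace.single (0 : Fin 3) (4 * ((m : ℝ) - 1))

/-- The set `Q_k = {q_1, …, q_k} ⊆ ℝ³` (so `Q_0 = ∅`). -/
def Qset (k : ℕ) : Set R3 := qpt '' Set.Icc 1 k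

open scoped unitInterval

section Bump

variable {n : ℕ}

/-- The perturbation of the identity of `ℝ³` that translates `a i` towards `b i` inside the ball of
radius `r` around `a i`, for each `i`. -/
def bumpMove (r : ℝ) (a b : Fin n → R3) (x : R3) : R3 :=
  x + ∑ i, max 0 (1 - ‖x - a i‖ / r) • (b i - a i)

lemma norm_bumpMove_sub_sub_le {r : ℝ} (hr : 0 < r) {a b : Fin n → R3}
    (hab : ∀ i, ‖b i - a i‖ ≤ r / (2 * (n + 1))) (x y : R3) :
    ‖bumpMove r a b x - bumpMove r a b y - (x - y)‖ ≤ 1 / 2 * ‖x - y‖ := by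
  have hsum : bumpMove r a b x - bumpMove r a b y - (x - y) =
      ∑ i, (max 0 (1 - ‖x - a i‖ / r) - max 0 (1 - ‖y - a i‖ / r)) • (b i - a i) := by
    simp only [bumpMove, sub_smul, Finset.sum_sub_distrib]
    abel
  have hterm (i : Fin n) :
      ‖(max 0 (1 - ‖x - a i‖ / r) - max 0 (1 - ‖y - a i‖ / r)) • (b i - a i)‖ ≤
        ‖x - y‖ / r * (r / (2 * (n + 1))) := by
    rw [norm_smul]
    refine mul_le_mul ?_ (hab i) (norm_nonneg _) (by positivity)
    rw [Real.norm_eq_abs]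
    refine (abs_max_sub_max_le_max _ _ _ _).trans ?_
    rw [sub_self, abs_zero, max_eq_right (abs_nonneg _)]
    have h : 1 - ‖x - a i‖ / r - (1 - ‖y - a i‖ / r) = (‖y - a i‖ - ‖x - a i‖) / r := by ring
    rw [h, abs_div, abs_of_pos hr]
    gcongr
    refine (abs_norm_sub_norm_le _ _).trans_eq ?_
    rw [sub_sub_sub_cancel_right, norm_sub_rev]
  rw [hsum]
  refine (norm_sum_le_of_le _ fun i _ ↦ hterm i).trans ?_
  rw [Finset.sum_const, Finset.card_univ, Fintype.card_fin, nsmul_eq_mul]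
  have h : (n : ℝ) * (‖x - y‖ / r * (r / (2 * (n + 1)))) =
      1 / 2 * ‖x - y‖ * (n / (n + 1)) := by
    field_simp
  rw [h]
  refine mul_le_of_le_one_right (by positivity) ?_
  rw [div_le_one (by positivity)]
  linarith

lemma bumpMove_injective {r : ℝ} (hr : 0 < r) {a b : Fin n → R3}
    (hab : ∀ i, ‖b i - a i‖ ≤ r / (2 * (n + 1))) : Function.Injective (bumpMove r a b) := by
  intro x y hxy
  have h := norm_bumpMove_sub_sub_le hr hab x y
  rw [hxy, sub_self, zero_sub, norm_neg] at h
  have : ‖x - y‖ = 0 := by linarith [norm_nonneg (x - y)]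
  exact sub_eq_zero.1 (norm_eq_zero.1 this)

lemma bumpMove_of_le {r : ℝ} (hr : 0 < r) {a b : Fin n → R3} {x : R3}
    (hx : ∀ i, r ≤ ‖x - a i‖) : bumpMove r a b x = x := by
  rw [bumpMove, Finset.sum_eq_zero, add_zero]
  intro i _
  rw [max_eq_left, zero_smul]
  rw [sub_nonpos, one_le_div hr]
  exact hx i

lemma bumpMove_apply_self {r : ℝ} (hr : 0 < r) {a b : Fin n → R3}
    (ha : ∀ i j, i ≠ j → r ≤ ‖a i - a j‖) (i : Fin n) : bumpMove r a b (a i) = b i := by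
  rw [bumpMove, Finset.sum_eq_single i]
  · simp
  · intro j _ hji
    rw [max_eq_left, zero_smul]
    rw [sub_nonpos, one_le_div hr]
    exact ha i j hji.symm
  · simp

lemma bumpMove_self (r : ℝ) (a : Fin n → R3) : bumpMove r a a = id := by
  ext1 x
  simp [bumpMove]

lemma continuous_bumpMove (r : ℝ) :
    Continuous fun p : (Fin n → R3) × (Fin n → R3) × R3 ↦ bumpMove r p.1 p.2.1 p.2.2 := by
  unfold bumpMove
  fun_prop

end Bump

section Carries

variable {Y : Type*} [TopologicalSpace Y] {n : ℕ}

/-- `Carries Q S a b` says that there is a continuous family, parametrised by `Y`, of injective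
self-maps of `ℝ³` fixing `Q` pointwise and taking the tuple `a y` to `b y`; moreover these maps are
the identity for `y ∈ S`. -/
def Carries (Q : Set R3) (S : Set Y) (a b : Y → Fin n → R3) : Prop :=
  ∃ Φ : Y → R3 → R3, Continuous (fun p : Y × R3 ↦ Φ p.1 p.2) ∧
    (∀ y, Function.Injective (Φ y)) ∧ (∀ y, ∀ q ∈ Q, Φ y q = q) ∧
    (∀ y i, Φ y (a y i) = b y i) ∧ ∀ y ∈ S, Φ y = id

lemma Carries.refl (Q : Set R3) (S : Set Y) (a : Y → Fin n → R3) : Carries Q S a a :=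
  ⟨fun _ ↦ id, continuous_snd, fun _ ↦ Function.injective_id, fun _ _ _ ↦ rfl, fun _ _ ↦ rfl,
    fun _ _ ↦ rfl⟩

lemma Carries.trans {Q : Set R3} {S : Set Y} {a b c : Y → Fin n → R3} (hab : Carries Q S a b)
    (hbc : Carries Q S b c) : Carries Q S a c := by
  obtain ⟨Φ, hΦ, hΦi, hΦQ, hΦab, hΦS⟩ := hab
  obtain ⟨Ψ, hΨ, hΨi, hΨQ, hΨbc, hΨS⟩ := hbc
  refine ⟨fun y ↦ Ψ y ∘ Φ y, hΨ.comp (continuous_fst.prodMk hΦ), fun y ↦ (hΨi y).comp (hΦi y),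
    fun y q hq ↦ ?_, fun y i ↦ ?_, fun y hy ↦ ?_⟩
  · simp [hΦQ y q hq, hΨQ y q hq]
  · simp [hΦab, hΨbc]
  · simp [hΦS y hy, hΨS y hy]

lemma Carries.of_norm_sub_le {Q : Set R3} {S : Set Y} {a b : Y → Fin n → R3} (ha : Continuous a)
    (hb : Continuous b) {r : ℝ} (hr : 0 < r) (hsep : ∀ y i j, i ≠ j → r ≤ ‖a y i - a y j‖)
    (hQ : ∀ y i, ∀ q ∈ Q, r ≤ ‖q - a y i‖)
    (hab : ∀ y i, ‖b y i - a y i‖ ≤ r / (2 * (n + 1))) (hS : ∀ y ∈ S, a y = b y) :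
    Carries Q S a b := by
  refine ⟨fun y ↦ bumpMove r (a y) (b y), ?_, fun y ↦ bumpMove_injective hr (hab y),
    fun y q hq ↦ bumpMove_of_le hr fun i ↦ hQ y i q hq,
    fun y i ↦ bumpMove_apply_self hr (hsep y) i, fun y hy ↦ ?_⟩
  · exact (continuous_bumpMove r).comp
      ((ha.comp continuous_fst).prodMk ((hb.comp continuous_fst).prodMk continuous_snd))
  · simp only [hS y hy, bumpMove_self]

end Carries

lemma eventually_le_of_forall_pos {Z : Type*} [TopologicalSpace Z] [CompactSpace Z] {f : Z → ℝ}
    (hf : Continuous f) (hpos : ∀ z, 0 < f z) : ∀ᶠ r in 𝓝[>] (0 : ℝ), ∀ z, r ≤ f z := by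
  obtain ⟨r, hr, h⟩ := isCompact_univ.exists_forall_le' hf.continuousOn (a := 0) fun z _ ↦ hpos z
  filter_upwards [Ioc_mem_nhdsGT hr] with s hs z
  exact hs.2.trans (h z trivial)

namespace Conf

variable {n : ℕ} {A : Set R3}

instance : CoeFun (Conf n A) fun _ ↦ Fin n → R3 := ⟨Subtype.val⟩

lemma continuous_coe : Continuous fun c : Conf n A ↦ (c : Fin n → R3) := continuous_subtype_val

lemma continuous_apply (i : Fin n) : Continuous fun c : Conf n A ↦ c i :=
  (_root_.continuous_apply i).comp continuous_coe

lemma exists_separation {Z : Type*} [TopologicalSpace Z] [CompactSpace Z] {Q : Set R3}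
    (hQ : Q.Finite) {c : Z → Conf n Qᶜ} (hc : Continuous c) :
    ∃ r > 0, (∀ z i j, i ≠ j → r ≤ ‖c z i - c z j‖) ∧ ∀ z i, ∀ q ∈ Q, r ≤ ‖q - c z i‖ := by
  have h₁ : ∀ᶠ r in 𝓝[>] (0 : ℝ), ∀ i j, i ≠ j → ∀ z, r ≤ ‖c z i - c z j‖ := by
    refine Filter.eventually_all.2 fun i ↦ Filter.eventually_all.2 fun j ↦ ?_
    by_cases hij : i = j
    · simp [hij]
    · refine (eventually_le_of_forall_pos (((continuous_apply i).comp hc).sub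
        ((continuous_apply j).comp hc)).norm fun z ↦ ?_).mono fun r hr _ ↦ hr
      exact norm_pos_iff.2 (sub_ne_zero.2 fun h ↦ hij ((c z).2.1 h))
  have h₂ : ∀ᶠ r in 𝓝[>] (0 : ℝ), ∀ q ∈ Q, ∀ i z, r ≤ ‖q - c z i‖ := by
    refine (Filter.eventually_all_finite hQ).2 fun q hq ↦ Filter.eventually_all.2 fun i ↦ ?_
    refine eventually_le_of_forall_pos
      (continuous_const.sub ((continuous_apply i).comp hc)).norm fun z ↦ ?_
    exact norm_pos_iff.2 (sub_ne_zero.2 fun h ↦ (c z).2.2 i (h ▸ hq))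
  obtain ⟨r, ⟨hr₁, hr₂⟩, hr⟩ := ((h₁.and h₂).and self_mem_nhdsWithin).exists
  exact ⟨r, hr, fun z i j hij ↦ hr₁ i j hij z, fun z i q hq ↦ hr₂ q hq i z⟩

/-- A compact family of paths of configurations is followed by an ambient family. -/
lemma carries_of_homotopy {Y : Type*} [PseudoMetricSpace Y] [CompactSpace Y] {Q : Set R3}
    (hQ : Q.Finite) {H : I × Y → Conf n Qᶜ} (hH : Continuous H) :
    Carries Q {y | ∀ t, H (t, y) = H (0, y)} (fun y ↦ H (0, y)) fun y ↦ H (1, y) := by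
  obtain ⟨r, hr, hsep, hrQ⟩ := exists_separation hQ hH
  have huc : UniformContinuous fun z ↦ (H z : Fin n → R3) :=
    CompactSpace.uniformContinuous_of_continuous (continuous_coe.comp hH)
  obtain ⟨δ, hδ, hHδ⟩ := Metric.uniformContinuous_iff.1 huc (r / (2 * (n + 1))) (by positivity)
  obtain ⟨M, hM⟩ := exists_nat_one_div_lt hδ
  let t (j : ℕ) : I := Set.projIcc 0 1 zero_le_one (j * (1 / ((M : ℝ) + 1)))
  have ht0 : t 0 = 0 := by simp [t]
  have ht1 : t (M + 1) = 1 := by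
    have : ((M : ℝ) + 1) ≠ 0 := by positivity
    simp [t, this]
  have hstep (j : ℕ) : dist (t (j + 1)) (t j) < δ := by
    refine lt_of_le_of_lt ?_ hM
    rw [Subtype.dist_eq, Real.dist_eq]
    refine (Set.abs_projIcc_sub_projIcc zero_le_one).trans_eq ?_
    rw [← sub_mul]
    push_cast
    rw [add_sub_cancel_left, one_mul, abs_of_pos (by positivity)]
  have key (j : ℕ) : Carries Q {y | ∀ t, H (t, y) = H (0, y)} (fun y ↦ H (0, y))
      fun y ↦ H (t j, y) := by
    induction j with
    | zero => rw [ht0]; exact Carries.refl ..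
    | succ j ih =>
      refine ih.trans (Carries.of_norm_sub_le (by fun_prop) (by fun_prop) hr
        (fun y ↦ hsep _) (fun y ↦ hrQ _) (fun y i ↦ ?_) fun y hy ↦ ?_)
      · have hd : dist (t (j + 1), y) (t j, y) < δ := by
          simpa [Prod.dist_eq, hδ] using hstep j
        rw [← dist_eq_norm]
        exact (dist_le_pi_dist _ _ i).trans (hHδ hd).le
      · rw [hy (t j), hy (t (j + 1))]
  simpa only [ht1] using key (M + 1)

end Conf

section Homogeneity

lemma exists_homeomorph_of_norm_sub_le {S : Set R3} {u v : R3} {r : ℝ} (hr : 0 < r)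
    (hS : ∀ q ∈ S, r ≤ ‖q - u‖) (huv : ‖v - u‖ ≤ r / 4) :
    ∃ h : R3 ≃ₜ R3, (∀ q ∈ S, h q = q) ∧ h u = v := by
  have hab : ∀ i : Fin 1, ‖(fun _ : Fin 1 ↦ v) i - (fun _ : Fin 1 ↦ u) i‖ ≤
      r / (2 * ((1 : ℕ) + 1)) := fun _ ↦ huv.trans_eq (by norm_num)
  have happ : ApproximatesLinearOn (bumpMove r (fun _ : Fin 1 ↦ u) fun _ ↦ v)
      (ContinuousLinearEquiv.refl ℝ R3 : R3 →L[ℝ] R3) Set.univ (1 / 2) := fun x _ y _ ↦ by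
    simpa using norm_bumpMove_sub_sub_le hr hab x y
  refine ⟨happ.toHomeomorph _ (Or.inr ?_), fun q hq ↦ ?_, ?_⟩
  · have hnorm : ‖((ContinuousLinearEquiv.refl ℝ R3).symm : R3 →L[ℝ] R3)‖₊ = 1 :=
      NNReal.eq ContinuousLinearMap.norm_id
    rw [hnorm, inv_one]
    exact NNReal.half_lt_self one_ne_zero
  · exact bumpMove_of_le hr fun _ ↦ hS q hq
  · exact bumpMove_apply_self (a := fun _ : Fin 1 ↦ u) (b := fun _ ↦ v) hr
      (fun i j hij ↦ (hij (Subsingleton.elim i j)).elim) 0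

lemma exists_homeomorph_apply_eq {S : Set R3} (hS : S.Finite) {u v : R3} (hu : u ∉ S)
    (hv : v ∉ S) : ∃ h : R3 ≃ₜ R3, (∀ q ∈ S, h q = q) ∧ h u = v := by
  have hrank : 1 < Module.rank ℝ R3 := by
    rw [← Module.finrank_eq_rank, finrank_euclideanSpace_fin]
    norm_num
  have hconn := (hS.countable.isConnected_compl_of_one_lt_rank hrank).isPreconnected
  let P : R3 → R3 → Prop := fun u v ↦ ∃ h : R3 ≃ₜ R3, (∀ q ∈ S, h q = q) ∧ h u = v
  refine hconn.induction₂' P (fun x hx ↦ ?_) ?_ hu hv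
  · obtain ⟨r, hr, hball⟩ := Metric.isOpen_iff.1 hS.isClosed.isOpen_compl x hx
    have hev : ∀ᶠ y in 𝓝[Sᶜ] x, y ∈ Metric.ball x (r / 4) :=
      mem_nhdsWithin_of_mem_nhds (Metric.ball_mem_nhds x (by positivity))
    filter_upwards [hev] with y hy
    obtain ⟨h, hq, hxy⟩ : P x y := by
      refine exists_homeomorph_of_norm_sub_le hr (fun q hq ↦ ?_) (mem_ball_iff_norm.1 hy).le
      by_contra! hlt
      exact hball (mem_ball_iff_norm.2 hlt) hq
    exact ⟨⟨h, hq, hxy⟩, h.symm, fun q hqS ↦ by rw [h.symm_apply_eq, hq q hqS],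
      by rw [h.symm_apply_eq, hxy]⟩
  · rintro x y z _ _ _ ⟨h, hq, rfl⟩ ⟨g, gq, rfl⟩
    exact ⟨h.trans g, fun q hqS ↦ by simp [hq q hqS, gq q hqS], rfl⟩

lemma exists_homeomorph_comp_eq {n : ℕ} {S : Set R3} (hS : S.Finite) (x y : Conf n Sᶜ) :
    ∃ h : R3 ≃ₜ R3, (∀ q ∈ S, h q = q) ∧ ∀ i, h (x i) = y i := by
  induction n with
  | zero => exact ⟨Homeomorph.refl _, fun _ _ ↦ rfl, fun i ↦ i.elim0⟩
  | succ n ih =>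
    obtain ⟨h, hq, hxy⟩ := ih
      ⟨fun i ↦ x i.castSucc, x.2.1.comp (Fin.castSucc_injective n), fun i ↦ x.2.2 _⟩
      ⟨fun i ↦ y i.castSucc, y.2.1.comp (Fin.castSucc_injective n), fun i ↦ y.2.2 _⟩
    dsimp only at hxy
    obtain ⟨g, gq, gxy⟩ := exists_homeomorph_apply_eq
      (S := S ∪ Set.range fun i : Fin n ↦ y i.castSucc) (hS.union (Set.finite_range _))
      (u := h (x (Fin.last n))) (v := y (Fin.last n)) (by
        rintro (hmem | ⟨i, hi⟩)
        · refine x.2.2 (Fin.last n) ?_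
          rwa [h.injective (hq _ hmem)] at hmem
        · dsimp only at hi
          rw [← hxy] at hi
          exact (Fin.castSucc_lt_last i).ne (x.2.1 (h.injective hi))) (by
        rintro (hmem | ⟨i, hi⟩)
        · exact y.2.2 _ hmem
        · exact (Fin.castSucc_lt_last i).ne (y.2.1 hi))
    refine ⟨h.trans g, fun q hqS ↦ ?_, fun i ↦ ?_⟩
    · simp [hq q hqS, gq q (Or.inl hqS)]
    · refine Fin.lastCases gxy (fun i ↦ ?_) i
      simpa [hxy] using gq _ (Or.inr ⟨i, rfl⟩)

lemma apply_notMem_of_fixes {S : Set R3} {f : R3 → R3} (hf : Function.Injective f)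
    (hS : ∀ q ∈ S, f q = q) {x : R3} (hx : x ∉ S) : f x ∉ S :=
  fun hmem ↦ hx (hf (hS _ hmem) ▸ hmem)

lemma symm_fixes {S : Set R3} {h : R3 ≃ₜ R3} (hS : ∀ q ∈ S, h q = q) : ∀ q ∈ S, h.symm q = q :=
  fun q hq ↦ by rw [h.symm_apply_eq, hS q hq]

/-- The self-homeomorphism of a configuration space induced by an ambient homeomorphism. -/
def Conf.homeomorph (n : ℕ) {S : Set R3} (h : R3 ≃ₜ R3) (hS : ∀ q ∈ S, h q = q) :
    Conf n Sᶜ ≃ₜ Conf n Sᶜ where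
  toFun c := ⟨fun i ↦ h (c i), h.injective.comp c.2.1,
    fun i ↦ apply_notMem_of_fixes h.injective hS (c.2.2 i)⟩
  invFun c := ⟨fun i ↦ h.symm (c i), h.symm.injective.comp c.2.1,
    fun i ↦ apply_notMem_of_fixes h.symm.injective (symm_fixes hS) (c.2.2 i)⟩
  left_inv _ := Subtype.ext (funext fun _ ↦ h.symm_apply_apply _)
  right_inv _ := Subtype.ext (funext fun _ ↦ h.apply_symm_apply _)
  continuous_toFun := Continuous.subtype_mk
    (continuous_pi fun i ↦ h.continuous.comp (Conf.continuous_apply i)) _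
  continuous_invFun := Continuous.subtype_mk
    (continuous_pi fun i ↦ h.symm.continuous.comp (Conf.continuous_apply i)) _

lemma Conf.exists_homeomorph_apply_eq {n : ℕ} {S : Set R3} (hS : S.Finite) (x y : Conf n Sᶜ) :
    ∃ h : Conf n Sᶜ ≃ₜ Conf n Sᶜ, h x = y := by
  obtain ⟨h, hq, hxy⟩ := exists_homeomorph_comp_eq hS x y
  exact ⟨Conf.homeomorph n h hq, Subtype.ext (funext hxy)⟩

lemma exists_homeomorph_compl_apply_eq {S : Set R3} (hS : S.Finite) (x y : (Sᶜ : Set R3)) :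
    ∃ h : (Sᶜ : Set R3) ≃ₜ (Sᶜ : Set R3), h x = y := by
  obtain ⟨h, hq, hxy⟩ := _root_.exists_homeomorph_apply_eq hS x.2 y.2
  refine ⟨h.subtype fun z ↦ ⟨apply_notMem_of_fixes h.injective hq, fun hz ↦ ?_⟩, Subtype.ext hxy⟩
  simpa using apply_notMem_of_fixes h.symm.injective (symm_fixes hq) hz

end Homogeneity

namespace HomotopyGroup

variable {N : Type*} {X Y Z : Type*} [TopologicalSpace X] [TopologicalSpace Y] [TopologicalSpace Z]
  {x : X} {y : Y} {z : Z}

/-- The generalized loop obtained by composing with a pointed continuous map. -/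
def _root_.GenLoop.map (f : C(X, Y)) (hf : f x = y) (p : GenLoop N X x) : GenLoop N Y y :=
  ⟨f.comp p.1, fun t ht ↦ by
    rw [ContinuousMap.comp_apply, ← hf]
    exact congrArg f (p.2 t ht)⟩

variable [DecidableEq N] [Nonempty N]

/-- The homomorphism of homotopy groups induced by a pointed continuous map. -/
def map (f : C(X, Y)) (hf : f x = y) : HomotopyGroup N X x →* HomotopyGroup N Y y :=
  MonoidHom.mk' (Quotient.map (GenLoop.map f hf) fun _ _ h ↦ h.comp_continuousMap f) <| by
    rintro ⟨p⟩ ⟨q⟩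
    let i : N := Classical.arbitrary N
    have h₁ := mul_spec (i := i) (p := p) (q := q)
    have h₂ := mul_spec (i := i) (p := GenLoop.map f hf p) (q := GenLoop.map f hf q)
    refine (congrArg _ h₁).trans (Eq.trans ?_ h₂.symm)
    refine congrArg (Quotient.mk _) ?_
    ext t
    change f (GenLoop.transAt i q p t) = _
    simp only [GenLoop.transAt, GenLoop.coe_copy]
    split_ifs <;> rfl

lemma map_map (f : C(X, Y)) (hf : f x = y) (g : C(Y, Z)) (hg : g y = z)
    (γ : HomotopyGroup N X x) :
    map g hg (map f hf γ) = map (g.comp f) (by simp [hf, hg]) γ := by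
  obtain ⟨p⟩ := γ
  rfl

lemma map_eq_self {f : C(X, X)} (hf : f x = x) (h : ∀ x', f x' = x') (γ : HomotopyGroup N X x) :
    map f hf γ = γ := by
  obtain ⟨p⟩ := γ
  exact congrArg (Quotient.mk _) (GenLoop.ext _ _ fun t ↦ h _)

/-- The isomorphism of homotopy groups induced by a homeomorphism. -/
def congr (h : X ≃ₜ Y) (hx : h x = y) : HomotopyGroup N X x ≃* HomotopyGroup N Y y where
  toFun := map (h : C(X, Y)) hx
  invFun := map (h.symm : C(Y, X)) (by simp [← hx])
  left_inv γ := by rw [map_map, map_eq_self _ (by simp)]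
  right_inv γ := by rw [map_map, map_eq_self _ (by simp)]
  map_mul' := map_mul _

end HomotopyGroup

lemma finite_Qset (k : ℕ) : (Qset k).Finite := (Set.finite_Icc 1 k).image _

lemma qpt_injective : Function.Injective qpt := by
  intro a b hab
  have h := congrArg (fun v : R3 ↦ v 0) hab
  simpa [qpt] using h

lemma qpt_succ_notMem_Qset (k : ℕ) : qpt (k + 1) ∉ Qset k := by
  rintro ⟨j, hj, h⟩
  have := qpt_injective h
  have := hj.2
  omega

lemma Qset_succ (k : ℕ) : Qset (k + 1) = insert (qpt (k + 1)) (Qset k) := by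
  rw [Qset, ← Set.insert_Icc_right_eq_Icc_add_one (by omega), Set.image_insert_eq, Qset]

lemma norm_le_of_mem_Qset {k : ℕ} {q : R3} (hq : q ∈ Qset k) : ‖q‖ ≤ 4 * k := by
  obtain ⟨j, ⟨hj1, hjk⟩, rfl⟩ := hq
  have h1 : (1 : ℝ) ≤ j := by exact_mod_cast hj1
  have h2 : (j : ℝ) ≤ k := by exact_mod_cast hjk
  rw [qpt, PiLp.norm_single, Real.norm_eq_abs, abs_of_nonneg (by linarith)]
  linarith

namespace Conf

variable {m k : ℕ}

/-- The Fadell–Neuwirth projection onto the first point. -/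
def proj (m : ℕ) (A : Set R3) : C(Conf (m + 1) A, A) :=
  ⟨fun c ↦ ⟨c 0, c.2.2 0⟩, (continuous_apply 0).subtype_mk _⟩

/-- The inclusion of the fibre of the Fadell–Neuwirth projection over `q_{k+1}`. -/
def fiberIncl (m k : ℕ) : C(Conf m (Qset (k + 1))ᶜ, Conf (m + 1) (Qset k)ᶜ) where
  toFun c := ⟨Fin.cons (qpt (k + 1)) c, Fin.cons_injective_iff.2
    ⟨by
      rintro ⟨i, hi⟩
      exact c.2.2 i ((Qset_succ k).symm.subset (hi ▸ Set.mem_insert _ _)), c.2.1⟩,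
    Fin.cases (qpt_succ_notMem_Qset k) fun i hi ↦
      c.2.2 i ((Qset_succ k).symm.subset (Set.mem_insert_of_mem _ hi))⟩
  continuous_toFun := by
    refine Continuous.subtype_mk (continuous_pi (Fin.cases ?_ fun i ↦ ?_)) _
    · exact continuous_const
    · exact continuous_apply i

/-- The remaining points of a configuration in the fibre over `q_{k+1}`. -/
def tail (c : Conf (m + 1) (Qset k)ᶜ) (hc : c 0 = qpt (k + 1)) : Conf m (Qset (k + 1))ᶜ :=
  ⟨fun i ↦ c i.succ, c.2.1.comp (Fin.succ_injective m), fun i hi ↦ by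
    rw [Qset_succ, Set.mem_insert_iff, ← hc] at hi
    exact hi.elim (fun h ↦ Fin.succ_ne_zero i (c.2.1 h)) (c.2.2 _)⟩

lemma fiberIncl_tail (c : Conf (m + 1) (Qset k)ᶜ) (hc : c 0 = qpt (k + 1)) :
    fiberIncl m k (tail c hc) = c :=
  Subtype.ext (funext (Fin.cases hc.symm fun _ ↦ rfl))

lemma fiberIncl_injective (m k : ℕ) : Function.Injective (fiberIncl m k) := fun _ _ h ↦
  Subtype.ext (funext fun i ↦ congrFun (congrArg Subtype.val h) i.succ)

lemma continuous_tail {Y : Type*} [TopologicalSpace Y] {f : Y → Conf (m + 1) (Qset k)ᶜ}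
    (hf : Continuous f) (h : ∀ y, f y 0 = qpt (k + 1)) : Continuous fun y ↦ tail (f y) (h y) :=
  Continuous.subtype_mk (continuous_pi fun i : Fin m ↦ (continuous_apply i.succ).comp hf) _

/-- The points added by the cross section of the Fadell–Neuwirth projection. -/
def farPoint (k : ℕ) (u : R3) (i : ℕ) : R3 :=
  EuclideanSpace.single (0 : Fin 3) (‖u‖ + 4 * k + 1 + i)

lemma norm_farPoint (k : ℕ) (u : R3) (i : ℕ) : ‖farPoint k u i‖ = ‖u‖ + 4 * k + 1 + i := by
  rw [farPoint, PiLp.norm_single, Real.norm_eq_abs, abs_of_nonneg (by positivity)]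

/-- A cross section of the Fadell–Neuwirth projection. -/
def crossSection (m k : ℕ) : C(((Qset k)ᶜ : Set R3), Conf (m + 1) (Qset k)ᶜ) where
  toFun u := ⟨Fin.cons u.1 fun i : Fin m ↦ farPoint k u.1 i, Fin.cons_injective_iff.2
    ⟨by
      rintro ⟨i, hi⟩
      have := congrArg norm hi
      rw [norm_farPoint] at this
      have : (0 : ℝ) ≤ 4 * k + i := by positivity
      linarith, fun i j hij ↦ by
      have := congrArg norm hij
      simp only [norm_farPoint, add_right_inj, Nat.cast_inj] at this
      exact Fin.ext this⟩,
    Fin.cases u.2 fun i hi ↦ by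
      have := norm_le_of_mem_Qset hi
      rw [Fin.cons_succ, norm_farPoint] at this
      have : (0 : ℝ) ≤ ‖u.1‖ + i := by positivity
      linarith⟩
  continuous_toFun := by
    refine Continuous.subtype_mk (continuous_pi (Fin.cases ?_ fun i ↦ ?_)) _
    · exact continuous_subtype_val
    · simp only [Fin.cons_succ, farPoint]
      exact (PiLp.continuous_toLp 2 _).comp (continuous_pi fun j ↦ by
        simp only [Pi.single_apply]
        split_ifs <;> fun_prop)

@[simp]
lemma proj_crossSection (u : ((Qset k)ᶜ : Set R3)) : proj m _ (crossSection m k u) = u := rfl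

/-- Parallel transport of a compact family of configurations along paths in the base which respects
the cross section. -/
lemma exists_transport {Y : Type*} [PseudoMetricSpace Y] [CompactSpace Y]
    {f : Y → Conf (m + 1) (Qset k)ᶜ} (hf : Continuous f)
    {P : I × Y → ((Qset k)ᶜ : Set R3)} (hP : Continuous P)
    (hPf : ∀ y, P (0, y) = proj m _ (f y)) :
    ∃ g : Y → Conf (m + 1) (Qset k)ᶜ, Continuous g ∧ (∀ y, proj m _ (g y) = P (1, y)) ∧
      (∀ y, (∀ t, P (t, y) = P (0, y)) → g y = f y) ∧
      ∀ y, f y = crossSection m k (P (0, y)) → g y = crossSection m k (P (1, y)) := by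
  obtain ⟨Φ, hΦ, hΦi, hΦQ, hΦH, hΦS⟩ :=
    carries_of_homotopy (finite_Qset k) ((crossSection m k).continuous.comp hP)
  refine ⟨fun y ↦ ⟨fun i ↦ Φ y (f y i), (hΦi y).comp (f y).2.1,
    fun i ↦ apply_notMem_of_fixes (hΦi y) (hΦQ y) ((f y).2.2 i)⟩, ?_, fun y ↦ ?_, fun y hy ↦ ?_,
    fun y hy ↦ ?_⟩
  · exact Continuous.subtype_mk (continuous_pi fun i ↦
      hΦ.comp (continuous_id.prodMk ((continuous_apply i).comp hf))) _
  · refine Subtype.ext (Eq.trans ?_ (hΦH y 0))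
    exact congrArg (Φ y) (congrArg Subtype.val (hPf y)).symm
  · refine Subtype.ext (funext fun i ↦ ?_)
    have hid := hΦS y fun t ↦ congrArg (crossSection m k) (hy t)
    simp only [hid, id_eq]
  · refine Subtype.ext (funext fun i ↦ ?_)
    exact (congrArg (fun d : Conf (m + 1) (Qset k)ᶜ ↦ Φ y (d i)) hy).trans (hΦH y i)

end Conf

section Exactness

open Conf

variable {N : Type*} {m k : ℕ}

/-- The base point `q_{k+1}` of `ℝ³ ∖ Q_k`. -/
def basePt (k : ℕ) : ((Qset k)ᶜ : Set R3) := ⟨qpt (k + 1), qpt_succ_notMem_Qset k⟩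

/-- The base point of the fibre over `q_{k+1}` determined by the cross section. -/
def fiberPt (m k : ℕ) : Conf m (Qset (k + 1))ᶜ := tail (crossSection m k (basePt k)) rfl

lemma fiberIncl_fiberPt (m k : ℕ) : fiberIncl m k (fiberPt m k) = crossSection m k (basePt k) :=
  fiberIncl_tail _ _

lemma homotopic_const_of_fiberIncl [Fintype N]
    {p : GenLoop N (Conf m (Qset (k + 1))ᶜ) (fiberPt m k)}
    (h : GenLoop.Homotopic (GenLoop.map (fiberIncl m k) (fiberIncl_fiberPt m k) p)
      GenLoop.const) :
    GenLoop.Homotopic p GenLoop.const := by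
  obtain ⟨G⟩ := h
  have hG0 (z : I^ N) : G (0, z) = fiberIncl m k (p z) := G.apply_zero z
  have hG1 (z : I^ N) : G (1, z) = crossSection m k (basePt k) := G.apply_one z
  have hGb (t : I) (z : I^ N) (hz : z ∈ Cube.boundary N) :
      G (t, z) = crossSection m k (basePt k) := by
    refine (G.prop t z hz).trans ((G.apply_zero z).symm.trans ?_)
    rw [hG0, ← fiberIncl_fiberPt]
    exact congrArg _ (p.2 z hz)
  have hproj0 (z : I^ N) : proj m _ (G (0, z)) = basePt k := by
    rw [hG0]; rfl
  obtain ⟨g, hg, hgP, hgf, hgs⟩ := exists_transport (Y := I × I^ N) (f := G)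
    (P := fun y ↦ proj m _ (G (y.2.1 * unitInterval.symm y.1, y.2.2))) G.continuous
    (by fun_prop) (fun y ↦ by simp)
  have hg0 (y : I × I^ N) : g y 0 = qpt (k + 1) := by
    have := hgP y
    simp only [unitInterval.symm_one, mul_zero, hproj0] at this
    exact congrArg Subtype.val this
  refine ⟨⟨⟨⟨fun y ↦ tail (g y) (hg0 y), continuous_tail hg hg0⟩, fun z ↦ ?_, fun z ↦ ?_⟩, ?_⟩⟩
  · refine fiberIncl_injective m k ?_
    refine (fiberIncl_tail _ (hg0 _)).trans ((hgf _ fun t ↦ ?_).trans (hG0 z))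
    simp
  · refine fiberIncl_injective m k ?_
    refine (fiberIncl_tail _ (hg0 _)).trans ((hgs _ ?_).trans ?_)
    · simp [hG1]
    · simp only [unitInterval.symm_one, mul_zero, hproj0]
      exact (fiberIncl_fiberPt m k).symm
  · intro t z hz
    refine fiberIncl_injective m k ?_
    refine (fiberIncl_tail _ (hg0 _)).trans ((hgf _ fun s ↦ ?_).trans ?_)
    · simp [hGb _ _ hz]
    · rw [hGb _ _ hz, ← fiberIncl_fiberPt]
      exact congrArg _ (p.2 z hz).symm

lemma exists_homotopic_fiberIncl [Fintype N]
    {p : GenLoop N (Conf (m + 1) (Qset k)ᶜ) (crossSection m k (basePt k))}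
    (h : GenLoop.Homotopic (GenLoop.map (proj m _) (proj_crossSection _) p) GenLoop.const) :
    ∃ q : GenLoop N (Conf m (Qset (k + 1))ᶜ) (fiberPt m k),
      GenLoop.Homotopic p (GenLoop.map (fiberIncl m k) (fiberIncl_fiberPt m k) q) := by
  obtain ⟨P⟩ := h
  have hP0 (z : I^ N) : P (0, z) = proj m _ (p z) := P.apply_zero z
  have hP1 (z : I^ N) : P (1, z) = basePt k := P.apply_one z
  have hPb (t : I) (z : I^ N) (hz : z ∈ Cube.boundary N) : P (t, z) = P (0, z) :=
    (P.prop t z hz).trans (P.apply_zero z).symm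
  obtain ⟨g, hg, hgP, hgf, -⟩ := exists_transport (Y := I × I^ N) (f := fun y ↦ p y.2)
    (P := fun y ↦ P (y.1 * y.2.1, y.2.2)) (p.1.continuous.comp continuous_snd)
    (by fun_prop) (fun y ↦ by simp [hP0])
  have hg1 (z : I^ N) : g (1, z) 0 = qpt (k + 1) := by
    have := hgP (1, z)
    simp only [mul_one, hP1] at this
    exact congrArg Subtype.val this
  have hgb (t : I) (z : I^ N) (hz : z ∈ Cube.boundary N) : g (t, z) = p z :=
    hgf (t, z) fun s ↦ by simp only [hPb _ _ hz]
  refine ⟨⟨⟨fun z ↦ tail (g (1, z)) (hg1 z), continuous_tail (by fun_prop) hg1⟩, fun z hz ↦ ?_⟩,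
    ⟨⟨⟨⟨g, hg⟩, fun z ↦ hgf (0, z) (by simp), fun z ↦ ?_⟩, fun t z hz ↦ hgb t z hz⟩⟩⟩
  · refine fiberIncl_injective m k ?_
    refine (fiberIncl_tail _ (hg1 z)).trans ((hgb 1 z hz).trans ((p.2 z hz).trans ?_))
    exact (fiberIncl_fiberPt m k).symm
  · exact (fiberIncl_tail _ (hg1 z)).symm

variable [DecidableEq N] [Nonempty N]

lemma map_fiberIncl_injective [Fintype N] : Function.Injective
    (HomotopyGroup.map (N := N) (fiberIncl m k) (fiberIncl_fiberPt m k)) := by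
  rw [injective_iff_map_eq_one]
  rintro ⟨p⟩ h
  exact Quotient.sound (homotopic_const_of_fiberIncl (Quotient.exact h))

lemma exists_map_fiberIncl_eq [Fintype N]
    {γ : HomotopyGroup N (Conf (m + 1) (Qset k)ᶜ) (crossSection m k (basePt k))}
    (h : HomotopyGroup.map (proj m _) (proj_crossSection _) γ = 1) :
    ∃ φ, HomotopyGroup.map (fiberIncl m k) (fiberIncl_fiberPt m k) φ = γ := by
  obtain ⟨p⟩ := γ
  obtain ⟨q, hq⟩ := exists_homotopic_fiberIncl (Quotient.exact h)
  exact ⟨Quotient.mk _ q, (Quotient.sound hq).symm⟩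

lemma map_proj_map_fiberIncl (φ : HomotopyGroup N (Conf m (Qset (k + 1))ᶜ) (fiberPt m k)) :
    HomotopyGroup.map (proj m _) (proj_crossSection _)
      (HomotopyGroup.map (fiberIncl m k) (fiberIncl_fiberPt m k) φ) = 1 := by
  obtain ⟨q⟩ := φ
  rfl

lemma map_proj_map_crossSection (β : HomotopyGroup N ((Qset k)ᶜ : Set R3) (basePt k)) :
    HomotopyGroup.map (proj m _) (proj_crossSection _)
      (HomotopyGroup.map (crossSection m k) rfl β) = β := by
  obtain ⟨q⟩ := β
  rfl

end Exactness

/-- A split extension of groups with commutative total group is a direct product. -/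
lemma nonempty_mulEquiv_prod_of_split {E B F : Type*} [Group E] [Group B] [Group F]
    (hcomm : ∀ a b : E, a * b = b * a) (ι : F →* E) (p : E →* B) (s : B →* E)
    (hι : Function.Injective ι) (hpι : ∀ φ, p (ι φ) = 1) (hex : ∀ γ, p γ = 1 → ∃ φ, ι φ = γ)
    (hps : ∀ β, p (s β) = β) : Nonempty (E ≃* B × F) := by
  have hsι (β : B) (φ : F) : Commute (s β) (ι φ) := hcomm _ _
  refine ⟨(MulEquiv.ofBijective (MonoidHom.noncommCoprod s ι hsι) ⟨?_, fun γ ↦ ?_⟩).symm⟩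
  · rw [injective_iff_map_eq_one]
    rintro ⟨β, φ⟩ h
    rw [MonoidHom.noncommCoprod_apply] at h
    have hβ : β = 1 := by simpa [hps, hpι] using congrArg p h
    subst hβ
    rw [map_one, one_mul] at h
    rw [show φ = 1 from hι (h.trans (map_one ι).symm)]
    rfl
  · obtain ⟨φ, hφ⟩ := hex ((s (p γ))⁻¹ * γ) (by simp [hps])
    exact ⟨(p γ, φ), by simp [hφ]⟩

lemma nonempty_homotopyGroup_conf_mulEquiv (N : Type*) [Fintype N] [DecidableEq N] [Nonempty N]
    [Nontrivial N] (m k : ℕ) (c : Conf (m + 1) (Qset k)ᶜ) (b : ((Qset k)ᶜ : Set R3))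
    (c' : Conf m (Qset (k + 1))ᶜ) :
    Nonempty (HomotopyGroup N (Conf (m + 1) (Qset k)ᶜ) c ≃*
      HomotopyGroup N ((Qset k)ᶜ : Set R3) b × HomotopyGroup N (Conf m (Qset (k + 1))ᶜ) c') := by
  obtain ⟨hE, hEc⟩ := Conf.exists_homeomorph_apply_eq (finite_Qset k) c
    (Conf.crossSection m k (basePt k))
  obtain ⟨hB, hBb⟩ := exists_homeomorph_compl_apply_eq (finite_Qset k) (basePt k) b
  obtain ⟨hF, hFc⟩ := Conf.exists_homeomorph_apply_eq (finite_Qset (k + 1)) (fiberPt m k) c'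
  obtain ⟨e⟩ := nonempty_mulEquiv_prod_of_split
    (E := HomotopyGroup N (Conf (m + 1) (Qset k)ᶜ) (Conf.crossSection m k (basePt k)))
    (fun a b ↦ mul_comm a b)
    (HomotopyGroup.map (Conf.fiberIncl m k) (fiberIncl_fiberPt m k))
    (HomotopyGroup.map (Conf.proj m _) (Conf.proj_crossSection _))
    (HomotopyGroup.map (Conf.crossSection m k) rfl)
    map_fiberIncl_injective map_proj_map_fiberIncl (fun _ h ↦ exists_map_fiberIncl_eq h)
    map_proj_map_crossSection
  exact ⟨((HomotopyGroup.congr hE hEc).trans e).trans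
    ((HomotopyGroup.congr hB hBb).prodCongr (HomotopyGroup.congr hF hFc))⟩

/-- **Splitting of the homotopy groups of the Fadell--Neuwirth fibration.**
For `n ≥ 2`, `k ≥ 0` and `i ≥ 2`, and for every choice of basepoints, there is a group
isomorphism `π_i(Conf_n(ℝ³ ∖ Q_k)) ≅ π_i(ℝ³ ∖ Q_k) × π_i(Conf_{n−1}(ℝ³ ∖ Q_{k+1}))`.
(Here `i` is written as `i - 1 + 1`, which equals `i` since `i ≥ 2`.) -/
theorem homotopyGroup_fadellNeuwirth_splitting (n k i : ℕ) (hn : 2 ≤ n) (hi : 2 ≤ i)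
    (c : Conf n (Qset k)ᶜ) (b : ((Qset k)ᶜ : Set R3))
    (c' : Conf (n - 1) (Qset (k + 1))ᶜ) :
    Nonempty
      ((π_ (i - 1 + 1) (Conf n (Qset k)ᶜ) c) ≃*
        (π_ (i - 1 + 1) (((Qset k)ᶜ : Set R3)) b) ×
          (π_ (i - 1 + 1) (Conf (n - 1) (Qset (k + 1))ᶜ) c')) := by
  obtain ⟨m, rfl⟩ : ∃ m, n = m + 1 := ⟨n - 1, by omega⟩
  have : Nontrivial (Fin (i - 1 + 1)) := Fin.nontrivial_iff_two_le.2 (by omega)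
  exact nonempty_homotopyGroup_conf_mulEquiv (Fin (i - 1 + 1)) m k c b c'

end
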